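/- Let g be a centered Gaussian random variable with variance σ² > 0, and let λ > 0 and a ∈ ℝ. Then, as ε → 0⁺, E[ exp(−λ·g/ε) · (g + ε·a)⁺ ] ∼ (ε² / (λ² · σ · √(2π))) · e^{λ·a}; that is, the ratio of the left-hand side to the right-hand side tends to 1. -/

import Mathlib

open MeasureTheory ProbabilityTheory Filter

theorem tendsto_integral_comp_mul_sub_mul {p f : ℝ → ℝ} {C : ℝ} (a : ℝ) (hp : Continuous p)
    (hC : ∀ x, |p x| ≤ C) (hf : Integrable f) :
    Tendsto (fun ε : ℝ => ∫ y, p (ε * (y - a)) * f y) (nhds 0) (nhds (p 0 * ∫ y, f y)) := by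
  rw [← integral_const_mul]
  refine tendsto_integral_filter_of_dominated_convergence (fun y => C * |f y|) ?_ ?_
    (hf.abs.const_mul C) ?_
  · refine Eventually.of_forall fun ε => ?_
    exact (by fun_prop : Continuous fun y => p (ε * (y - a))).aestronglyMeasurable.mul
      hf.aestronglyMeasurable
  · refine Eventually.of_forall fun ε => Eventually.of_forall fun y => ?_
    rw [Real.norm_eq_abs, abs_mul]
    gcongr
    exact hC _
  · refine Eventually.of_forall fun y => ?_
    have h : Continuous fun ε : ℝ => p (ε * (y - a)) * f y := by fun_prop
    simpa using h.tendsto 0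

theorem exp_neg_mul_mul_max_zero_eq_indicator (r : ℝ) :
    (fun y : ℝ => Real.exp (-r * y) * max y 0) =
      (Set.Ioi 0).indicator fun y => y ^ ((2 : ℝ) - 1) * Real.exp (-(r * y)) := by
  ext y
  by_cases hy : 0 < y
  · rw [Set.indicator_of_mem (Set.mem_Ioi.2 hy), max_eq_left hy.le]
    norm_num
    ring
  · rw [Set.indicator_of_notMem (by simpa using hy), max_eq_right (not_lt.1 hy), mul_zero]

theorem integral_exp_neg_mul_mul_max_zero {r : ℝ} (hr : 0 < r) :
    ∫ y : ℝ, Real.exp (-r * y) * max y 0 = (r ^ 2)⁻¹ := by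
  rw [exp_neg_mul_mul_max_zero_eq_indicator, integral_indicator measurableSet_Ioi,
    Real.integral_rpow_mul_exp_neg_mul_Ioi two_pos hr]
  simp

theorem integrable_exp_neg_mul_mul_max_zero {r : ℝ} (hr : 0 < r) :
    Integrable fun y : ℝ => Real.exp (-r * y) * max y 0 := by
  refine Integrable.of_integral_ne_zero ?_
  rw [integral_exp_neg_mul_mul_max_zero hr]
  positivity

theorem integral_gaussianReal_exp_mul_max {v : NNReal} (hv : v ≠ 0) (r a : ℝ) {ε : ℝ}
    (hε : 0 < ε) :
    ∫ g, Real.exp (-r * g / ε) * max (g + ε * a) 0 ∂(gaussianReal 0 v) =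
      ε ^ 2 * Real.exp (r * a) *
        ∫ y, gaussianPDFReal 0 v (ε * (y - a)) * (Real.exp (-r * y) * max y 0) := by
  rw [integral_gaussianReal_eq_integral_smul hv]
  set G : ℝ → ℝ := fun g =>
    gaussianPDFReal 0 v g • (Real.exp (-r * g / ε) * max (g + ε * a) 0) with hG
  have h₁ : ∫ g, G g = ε * ∫ y, G (ε * (y - a)) := by
    rw [integral_sub_right_eq_self (fun y => G (ε * y)) a, Measure.integral_comp_mul_left,
      abs_of_pos (inv_pos.2 hε), smul_eq_mul, mul_inv_cancel_left₀ hε.ne']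
  rw [h₁, ← integral_const_mul, ← integral_const_mul]
  congr 1 with y
  have h₂ : -r * (ε * (y - a)) / ε = r * a + -r * y := by
    field_simp
    ring
  have h₃ : max (ε * (y - a) + ε * a) 0 = ε * max y 0 := by
    rw [mul_max_of_nonneg _ _ hε.le]
    ring_nf
  simp only [hG, smul_eq_mul, h₂, h₃, Real.exp_add]
  ring

theorem continuous_gaussianPDFReal (μ : ℝ) (v : NNReal) : Continuous (gaussianPDFReal μ v) := by
  rw [gaussianPDFReal_def]
  fun_prop

theorem abs_gaussianPDFReal_le (μ : ℝ) (v : NNReal) (x : ℝ) :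
    |gaussianPDFReal μ v x| ≤ (√(2 * Real.pi * v))⁻¹ := by
  rw [abs_of_nonneg (gaussianPDFReal_nonneg μ v x), gaussianPDFReal_def]
  refine mul_le_of_le_one_right (by positivity) (Real.exp_le_one_iff.2 ?_)
  exact div_nonpos_of_nonpos_of_nonneg (neg_nonpos.2 (sq_nonneg _)) (by positivity)

/-- Scaled Gaussian Laplace asymptotic: for `g ~ N(0, σ²)`, `λ > 0`, `a ∈ ℝ`,
`E[exp(−λ g/ε) (g + ε a)⁺] ∼ (ε² / (λ² σ √(2π))) e^{λ a}` as `ε → 0⁺`. -/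
theorem gaussian_laplace_scaled (σ lam a : ℝ) (hσ : 0 < σ) (hlam : 0 < lam) :
    Tendsto
      (fun ε : ℝ =>
        (∫ g, Real.exp (-lam * g / ε) * max (g + ε * a) 0
            ∂(gaussianReal 0 ⟨σ ^ 2, sq_nonneg σ⟩)) /
          (ε ^ 2 / (lam ^ 2 * σ * Real.sqrt (2 * Real.pi)) * Real.exp (lam * a)))
      (nhdsWithin 0 (Set.Ioi 0)) (nhds 1) := by
  set v : NNReal := ⟨σ ^ 2, sq_nonneg σ⟩
  have hv : v ≠ 0 := fun h => (pow_pos hσ 2).ne' (congrArg NNReal.toReal h)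
  have hp : gaussianPDFReal 0 v 0 = (σ * √(2 * Real.pi))⁻¹ := by
    have hvσ : (v : ℝ) = σ ^ 2 := rfl
    rw [gaussianPDFReal_def, hvσ, Real.sqrt_mul (by positivity), Real.sqrt_sq hσ.le, mul_comm σ]
    simp
  have h := ((tendsto_integral_comp_mul_sub_mul a (continuous_gaussianPDFReal 0 v)
    (abs_gaussianPDFReal_le 0 v) (integrable_exp_neg_mul_mul_max_zero hlam)).const_mul
      (lam ^ 2 * σ * √(2 * Real.pi))).mono_left
        (nhdsWithin_le_nhds (s := Set.Ioi (0 : ℝ)))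
  have hlim : lam ^ 2 * σ * √(2 * Real.pi) * (gaussianPDFReal 0 v 0 *
      ∫ y, Real.exp (-lam * y) * max y 0) = 1 := by
    rw [hp, integral_exp_neg_mul_mul_max_zero hlam]
    field_simp
  rw [hlim] at h
  refine h.congr' ?_
  filter_upwards [self_mem_nhdsWithin] with ε hε
  have hε : 0 < ε := hε
  rw [integral_gaussianReal_exp_mul_max hv lam a hε]
  field_simp
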